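/- For every finite connected graph G, every vertex w, and every BFS-tree T of G rooted at w, τ(G) ≤ 7·ρ_{w,T}(G) + 4 ≤ 7·τ(G) + 4. -/

import Mathlib

open SimpleGraph

noncomputable section

namespace HypPaper

variable {V : Type*}

/-- Gromov product `(y|z)_w = (d(y,w)+d(z,w)-d(y,z))/2`. -/
def gp (G : SimpleGraph V) (y z w : V) : ℝ :=
  ((G.dist y w : ℝ) + (G.dist z w : ℝ) - (G.dist y z : ℝ)) / 2

/-- `G` is `δ`-hyperbolic. -/
def IsDeltaHyp (G : SimpleGraph V) (δ : ℝ) : Prop :=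
  ∀ w x y z : V, gp G x y w ≥ min (gp G x z w) (gp G y z w) - δ

/-- The hyperbolicity `δ(G)`: least `δ ≥ 0` such that `G` is `δ`-hyperbolic. -/
def hyperbolicity (G : SimpleGraph V) : ℝ :=
  sInf {δ : ℝ | 0 ≤ δ ∧ IsDeltaHyp G δ}

/-- Pointed hyperbolicity `δ_w(G)` with respect to basepoint `w`. -/
def pointedHyp (G : SimpleGraph V) (w : V) : ℝ :=
  sInf {δ : ℝ | ∀ x y z : V, gp G x y w ≥ min (gp G x z w) (gp G y z w) - δ}

/-- A walk is a geodesic (shortest path) if its length equals the distance. -/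
def IsGeodesic (G : SimpleGraph V) {x y : V} (p : G.Walk x y) : Prop :=
  p.length = G.dist x y

/-- Thinness condition at corner `v` of a triangle, with sides `p : v → u` and `q : v → u'`. -/
def ThinCorner (G : SimpleGraph V) (δ : ℝ) {v u u' : V}
    (p : G.Walk v u) (q : G.Walk v u') : Prop :=
  ∀ a ∈ p.support, ∀ b ∈ q.support,
    G.dist v a = G.dist v b → (G.dist v a : ℝ) ≤ gp G u u' v →
    (G.dist a b : ℝ) ≤ δ

/-- A geodesic triangle with sides `p : x → y`, `q : y → z`, `r : z → x` is `δ`-thin. -/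
def TriangleThin (G : SimpleGraph V) (δ : ℝ) {x y z : V}
    (p : G.Walk x y) (q : G.Walk y z) (r : G.Walk z x) : Prop :=
  ThinCorner G δ p r.reverse ∧ ThinCorner G δ q p.reverse ∧ ThinCorner G δ r q.reverse

/-- Thinness `τ(G)`: least `δ` such that every geodesic triangle is `δ`-thin. -/
def thinness (G : SimpleGraph V) : ℝ :=
  sInf {δ : ℝ | ∀ (x y z : V) (p : G.Walk x y) (q : G.Walk y z) (r : G.Walk z x),
    IsGeodesic G p → IsGeodesic G q → IsGeodesic G r → TriangleThin G δ p q r}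

/-- The insize `max {d(y_z,z_y), d(z_x,x_z), d(x_y,y_x)}` of a geodesic triangle with
sides `p : x → y`, `q : y → z`, `r : z → x`. -/
def triInsize (G : SimpleGraph V) {x y z : V}
    (p : G.Walk x y) (q : G.Walk y z) (r : G.Walk z x) : ℝ :=
  max (G.dist (p.getVert ⌊gp G y z x⌋₊) (r.reverse.getVert ⌊gp G y z x⌋₊) : ℝ)
    (max (G.dist (q.getVert ⌊gp G z x y⌋₊) (p.reverse.getVert ⌊gp G z x y⌋₊) : ℝ)
      (G.dist (r.getVert ⌊gp G x y z⌋₊) (q.reverse.getVert ⌊gp G x y z⌋₊) : ℝ))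

/-- Insize `ι(G)`: least upper bound on insizes of geodesic triangles. -/
def insize (G : SimpleGraph V) : ℝ :=
  sInf {δ : ℝ | ∀ (x y z : V) (p : G.Walk x y) (q : G.Walk y z) (r : G.Walk z x),
    IsGeodesic G p → IsGeodesic G q → IsGeodesic G r → triInsize G p q r ≤ δ}

/-- A geodesic triangle with sides `p : x → y`, `q : y → z`, `r : z → x` is `δ`-slim. -/
def TriangleSlim (G : SimpleGraph V) (δ : ℝ) {x y z : V}
    (p : G.Walk x y) (q : G.Walk y z) (r : G.Walk z x) : Prop :=
  (∀ a ∈ p.support, ∃ b, (b ∈ q.support ∨ b ∈ r.support) ∧ (G.dist a b : ℝ) ≤ δ) ∧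
  (∀ a ∈ q.support, ∃ b, (b ∈ r.support ∨ b ∈ p.support) ∧ (G.dist a b : ℝ) ≤ δ) ∧
  (∀ a ∈ r.support, ∃ b, (b ∈ p.support ∨ b ∈ q.support) ∧ (G.dist a b : ℝ) ≤ δ)

/-- Slimness `ς(G)`: least `δ` such that every geodesic triangle is `δ`-slim. -/
def slimness (G : SimpleGraph V) : ℝ :=
  sInf {δ : ℝ | ∀ (x y z : V) (p : G.Walk x y) (q : G.Walk y z) (r : G.Walk z x),
    IsGeodesic G p → IsGeodesic G q → IsGeodesic G r → TriangleSlim G δ p q r}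

/-- The metric interval `I(u,v)`. -/
def interval (G : SimpleGraph V) (u v : V) : Set V :=
  {x | G.dist u x + G.dist x v = G.dist u v}

/-- Interval thinness `κ(G)`. -/
def intervalThinness (G : SimpleGraph V) : ℝ :=
  sInf {κ : ℝ | ∀ x y a b : V, a ∈ interval G x y → b ∈ interval G x y →
    G.dist x a = G.dist x b → (G.dist a b : ℝ) ≤ κ}

/-- A BFS-tree of `G` rooted at `w`: a spanning tree (encoded by its parent function)
in which the path from `w` to any vertex is a shortest path of `G`. -/
structure BFSTree (G : SimpleGraph V) (w : V) where
  parent : V → V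
  parent_root : parent w = w
  adj_parent : ∀ x, x ≠ w → G.Adj (parent x) x
  dist_parent : ∀ x, x ≠ w → G.dist w (parent x) + 1 = G.dist w x

/-- The vertex of the tree path `[w,x]_T` at distance `r` from the root `w`
(for `r ≤ d(w,x)`). -/
def treeVert (G : SimpleGraph V) {w : V} (T : BFSTree G w) (x : V) (r : ℕ) : V :=
  T.parent^[G.dist w x - r] x

/-- `v` lies on the tree path `[w,x]_T`. -/
def onRootPath (G : SimpleGraph V) {w : V} (T : BFSTree G w) (x v : V) : Prop :=
  ∃ i ≤ G.dist w x, v = T.parent^[i] x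

/-- The rooted insize `ρ_{w,T}(G) = max {d(x_y, y_x) : x, y ∈ V}`, where `x_y`, `y_x` are
the vertices of `[w,x]_T`, `[w,y]_T` at distance `⌊(x|y)_w⌋` from `w`. -/
def rootedInsize (G : SimpleGraph V) {w : V} (T : BFSTree G w) : ℝ :=
  sSup {ρ : ℝ | ∃ x y : V,
    ρ = (G.dist (treeVert G T x ⌊gp G x y w⌋₊) (treeVert G T y ⌊gp G x y w⌋₊) : ℝ)}

/-- The rooted thinness `μ_{w,T}(G)`. -/
def rootedThinness (G : SimpleGraph V) {w : V} (T : BFSTree G w) : ℝ :=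
  sSup {μ : ℝ | ∃ x y x' y' : V, onRootPath G T x x' ∧ onRootPath G T y y' ∧
    G.dist w x' = G.dist w y' ∧ (G.dist w x' : ℝ) ≤ gp G x y w ∧
    μ = (G.dist x' y' : ℝ)}


section GromovProduct

/-- The integer part of the Gromov product `(x|y)_w`. -/
def gpFloor (G : SimpleGraph V) (w x y : V) : ℕ :=
  (G.dist w x + G.dist w y - G.dist x y) / 2

lemma floor_gp {G : SimpleGraph V} (hG : G.Connected) (w x y : V) :
    ⌊gp G x y w⌋₊ = gpFloor G w x y := by
  have h : G.dist x y ≤ G.dist w x + G.dist w y := by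
    simpa [G.dist_comm (u := x) (v := w)] using hG.dist_triangle (u := x) (v := w) (w := y)
  unfold gp gpFloor
  rw [← Nat.floor_div_eq_div (K := ℝ), Nat.cast_sub h, G.dist_comm (u := x) (v := w),
    G.dist_comm (u := y) (v := w)]
  push_cast
  rfl

lemma gpFloor_bounds {G : SimpleGraph V} (hG : G.Connected) (w x y : V) :
    2 * gpFloor G w x y + G.dist x y ≤ G.dist w x + G.dist w y ∧
    G.dist w x + G.dist w y ≤ 2 * gpFloor G w x y + 1 + G.dist x y ∧
    gpFloor G w x y ≤ G.dist w x ∧ gpFloor G w x y ≤ G.dist w y := by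
  have h1 := hG.dist_triangle (u := x) (v := w) (w := y)
  have h2 := hG.dist_triangle (u := w) (v := x) (w := y)
  have h3 := hG.dist_triangle (u := w) (v := y) (w := x)
  rw [G.dist_comm (u := x) (v := w)] at h1
  rw [G.dist_comm (u := y) (v := x)] at h3
  unfold gpFloor
  omega

end GromovProduct

section TreePaths

variable {G : SimpleGraph V} {w : V} (T : BFSTree G w)

lemma dist_iterate_parent (x : V) {i : ℕ} (hi : i ≤ G.dist w x) :
    G.dist w (T.parent^[i] x) + i = G.dist w x := by
  induction i with
  | zero => simp
  | succ i ih =>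
    have ih := ih (by omega)
    have hne : T.parent^[i] x ≠ w := by
      intro h
      rw [h, G.dist_self] at ih
      omega
    have := T.dist_parent _ hne
    rw [Function.iterate_succ_apply']
    omega

lemma dist_treeVert (x : V) {k : ℕ} (hk : k ≤ G.dist w x) : G.dist w (treeVert G T x k) = k := by
  have := dist_iterate_parent T x (i := G.dist w x - k) (by omega)
  unfold treeVert
  omega

lemma treeVert_treeVert (x : V) {k l : ℕ} (hkl : k ≤ l) (hl : l ≤ G.dist w x) :
    treeVert G T (treeVert G T x l) k = treeVert G T x k := by
  have h := dist_treeVert T x hl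
  rw [treeVert, h]
  simp only [treeVert]
  rw [← Function.iterate_add_apply]
  congr 2
  omega

lemma dist_iterate_parent_le (hG : G.Connected) (x : V) (i : ℕ) :
    G.dist (T.parent^[i] x) x ≤ i := by
  induction i with
  | zero => simp
  | succ i ih =>
    have h1 : G.dist (T.parent (T.parent^[i] x)) (T.parent^[i] x) ≤ 1 := by
      by_cases h : T.parent^[i] x = w
      · rw [h, T.parent_root, G.dist_self]
        omega
      · exact (SimpleGraph.dist_eq_one_iff_adj.2 (T.adj_parent _ h)).le
    have := hG.dist_triangle (u := T.parent (T.parent^[i] x)) (v := T.parent^[i] x) (w := x)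
    rw [Function.iterate_succ_apply']
    omega

lemma dist_treeVert_self_le (hG : G.Connected) (x : V) (k : ℕ) :
    G.dist (treeVert G T x k) x ≤ G.dist w x - k :=
  dist_iterate_parent_le T hG x _

lemma dist_treeVert_treeVert_le (hG : G.Connected) (x : V) {k l : ℕ} (hkl : k ≤ l)
    (hl : l ≤ G.dist w x) : G.dist (treeVert G T x k) (treeVert G T x l) ≤ l - k := by
  have := dist_treeVert_self_le T hG (treeVert G T x l) k
  rwa [treeVert_treeVert T x hkl hl, dist_treeVert T x hl] at this

end TreePaths

section RootedInsize

variable {G : SimpleGraph V} {w : V}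

/-- The rooted insize of `G` with respect to `T` is at most `R`. -/
def RootedInsizeLE (T : BFSTree G w) (R : ℕ) : Prop :=
  ∀ x y : V, G.dist (treeVert G T x (gpFloor G w x y)) (treeVert G T y (gpFloor G w x y)) ≤ R

variable {T : BFSTree G w} {R : ℕ}

lemma RootedInsizeLE.dist_le_of_gpFloor (hG : G.Connected) (hR : RootedInsizeLE T R) (x y z : V) :
    (gpFloor G w x y ≤ gpFloor G w y z →
      G.dist x z + 2 * gpFloor G w x y ≤ G.dist w x + G.dist w z + 2 * R) ∧
    (gpFloor G w y z ≤ gpFloor G w x y →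
      G.dist x z + 2 * gpFloor G w y z ≤ G.dist w x + G.dist w z + 2 * R) := by
  obtain ⟨-, -, hx, hy⟩ := gpFloor_bounds hG w x y
  obtain ⟨-, -, hy', hz⟩ := gpFloor_bounds hG w y z
  have h1 := hR x y
  have h2 := hR y z
  generalize gpFloor G w x y = k at *
  generalize gpFloor G w y z = l at *
  have e1 := dist_treeVert_self_le T hG x k
  have e2 := dist_treeVert_self_le T hG z l
  rw [G.dist_comm] at e1
  have t1 := hG.dist_triangle (u := x) (v := treeVert G T x k) (w := z)
  have t2 := hG.dist_triangle (u := treeVert G T x k) (v := treeVert G T y k) (w := z)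
  have t3 := hG.dist_triangle (u := treeVert G T y k) (v := treeVert G T y l) (w := z)
  have t4 := hG.dist_triangle (u := treeVert G T y l) (v := treeVert G T z l) (w := z)
  constructor
  · intro h
    have := dist_treeVert_treeVert_le T hG y h hy'
    omega
  · intro h
    have := dist_treeVert_treeVert_le T hG y h hy
    rw [G.dist_comm] at this
    omega

/-- Below level `(x|y)_w`, the levels at which the tree paths to `x` and `y` are `R`-close
are spaced by at most `⌈R/2⌉`. -/
lemma RootedInsizeLE.exists_close_level (hG : G.Connected) (hR : RootedInsizeLE T R) (x y : V)
    {q : ℕ} (hq : q ≤ gpFloor G w x y) :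
    ∃ l ≤ q, q ≤ l + (R + 1) / 2 ∧ G.dist (treeVert G T x l) (treeVert G T y l) ≤ R := by
  obtain ⟨-, -, hx, hy⟩ := gpFloor_bounds hG w x y
  induction hq using Nat.decreasingInduction with
  | self => exact ⟨_, le_rfl, by omega, hR x y⟩
  | of_succ q hlt ih =>
    obtain ⟨l, hl, hql, hd⟩ := ih
    obtain hl | rfl := Nat.lt_or_eq_of_le hl
    · exact ⟨l, by omega, by omega, hd⟩
    have ex := dist_treeVert T x (k := q + 1) (by omega)
    have ey := dist_treeVert T y (k := q + 1) (by omega)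
    have hb := gpFloor_bounds hG w (treeVert G T x (q + 1)) (treeVert G T y (q + 1))
    have hg := hR (treeVert G T x (q + 1)) (treeVert G T y (q + 1))
    rw [ex, ey] at hb
    obtain h0 | hpos := Nat.eq_zero_or_pos (G.dist (treeVert G T x (q + 1)) (treeVert G T y (q + 1)))
    · refine ⟨q, le_rfl, by omega, ?_⟩
      rw [← treeVert_treeVert T x (k := q) (l := q + 1) (by omega) (by omega),
        ← treeVert_treeVert T y (k := q) (l := q + 1) (by omega) (by omega),
        hG.dist_eq_zero_iff.1 h0, G.dist_self]
      omega
    · refine ⟨gpFloor G w (treeVert G T x (q + 1)) (treeVert G T y (q + 1)), by omega, by omega, ?_⟩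
      rwa [treeVert_treeVert T x (by omega) (by omega),
        treeVert_treeVert T y (by omega) (by omega)] at hg

lemma RootedInsizeLE.dist_treeVert_le (hG : G.Connected) (hR : RootedInsizeLE T R) (x y : V)
    {p q : ℕ} (hpq : p ≤ q) (hq : q ≤ gpFloor G w x y) :
    G.dist (treeVert G T x p) (treeVert G T y q) ≤ max (q - p + R) (2 * R + 1) := by
  obtain ⟨-, -, hx, hy⟩ := gpFloor_bounds hG w x y
  obtain ⟨l, hl, hql, hd⟩ := hR.exists_close_level hG x y hq
  have t1 := hG.dist_triangle (u := treeVert G T x p) (v := treeVert G T x l)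
    (w := treeVert G T y q)
  have t2 := hG.dist_triangle (u := treeVert G T x l) (v := treeVert G T y l)
    (w := treeVert G T y q)
  have t3 := dist_treeVert_treeVert_le T hG y hl (by omega)
  obtain h | h := le_total p l
  · have := dist_treeVert_treeVert_le T hG x h (by omega)
    omega
  · have := dist_treeVert_treeVert_le T hG x h (by omega)
    rw [G.dist_comm] at this
    omega

lemma gpFloor_comm (G : SimpleGraph V) (w x y : V) : gpFloor G w x y = gpFloor G w y x := by
  unfold gpFloor
  rw [G.dist_comm (u := x), add_comm]

lemma RootedInsizeLE.dist_le_of_gpFloor_chain (hG : G.Connected) (hR : RootedInsizeLE T R)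
    {x y z u : V} (h : gpFloor G w x y ≤ gpFloor G w z u) :
    (gpFloor G w y z ≤ gpFloor G w x y →
      G.dist x u + 2 * gpFloor G w y z ≤ G.dist w x + G.dist w u + 3 * R) ∧
    (gpFloor G w x y ≤ gpFloor G w y z →
      G.dist x u + 2 * gpFloor G w x y ≤ G.dist w x + G.dist w u + 3 * R ∨
      G.dist x u + gpFloor G w x y + gpFloor G w z u ≤
        G.dist w x + G.dist w u + 4 * R + 1) := by
  obtain ⟨-, -, hx, hy⟩ := gpFloor_bounds hG w x y
  obtain ⟨-, -, hy', hz⟩ := gpFloor_bounds hG w y z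
  obtain ⟨-, -, hz', hu⟩ := gpFloor_bounds hG w z u
  have h1 := hR x y
  have h2 := hR y z
  have h3 := hR z u
  have hc := hR.dist_treeVert_le hG y z h
  generalize gpFloor G w x y = k at *
  generalize gpFloor G w y z = l at *
  generalize gpFloor G w z u = m at *
  have e1 := dist_treeVert_self_le T hG x k
  have e2 := dist_treeVert_self_le T hG u m
  rw [G.dist_comm] at e1
  have t1 := hG.dist_triangle (u := x) (v := treeVert G T x k) (w := u)
  have t2 := hG.dist_triangle (u := treeVert G T x k) (v := treeVert G T y k) (w := u)
  have t3 := hG.dist_triangle (u := treeVert G T y k) (v := treeVert G T z m) (w := u)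
  have t4 := hG.dist_triangle (u := treeVert G T z m) (v := treeVert G T u m) (w := u)
  have t5 := hG.dist_triangle (u := treeVert G T y k) (v := treeVert G T y l)
    (w := treeVert G T z m)
  have t6 := hG.dist_triangle (u := treeVert G T y l) (v := treeVert G T z l)
    (w := treeVert G T z m)
  constructor
  · intro hlk
    have e3 := dist_treeVert_treeVert_le T hG y hlk hy
    have e4 := dist_treeVert_treeVert_le T hG z (hlk.trans h) hz'
    rw [G.dist_comm] at e3
    omega
  · intro hkl
    obtain hml | hlm := le_total m l
    · have := hc hml
      omega
    · have e3 := dist_treeVert_treeVert_le T hG y hkl hy'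
      have e4 := dist_treeVert_treeVert_le T hG z hlm hz'
      omega

end RootedInsize

section Corner

variable {G : SimpleGraph V} {w : V} {T : BFSTree G w} {R : ℕ}

lemma RootedInsizeLE.dist_le_of_corner (hG : G.Connected) (hR : RootedInsizeLE T R)
    {v u u' a b : V} (ha : G.dist v a + G.dist a u = G.dist v u)
    (hb : G.dist v b + G.dist b u' = G.dist v u') (hab : G.dist v a = G.dist v b)
    (ht : 2 * G.dist v a + G.dist u u' ≤ G.dist v u + G.dist v u') :
    G.dist a b ≤ 7 * R + 4 := by
  wlog h : gpFloor G w a u ≤ gpFloor G w a v ∨ (gpFloor G w a v ≤ gpFloor G w a u ∧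
      gpFloor G w b v ≤ gpFloor G w b u' ∧ gpFloor G w a u ≤ gpFloor G w b u')
      generalizing u u' a b
  · rw [G.dist_comm]
    exact this hb ha hab.symm (by rw [G.dist_comm (u := u')]; omega) (by omega)
  obtain ⟨g1, g1', -⟩ := gpFloor_bounds hG w a u
  obtain ⟨g2, g2', -⟩ := gpFloor_bounds hG w a v
  obtain ⟨g3, g3', -⟩ := gpFloor_bounds hG w u v
  obtain ⟨g4, g4', -⟩ := gpFloor_bounds hG w u u'
  obtain ⟨g5, g5', -⟩ := gpFloor_bounds hG w u' v
  obtain ⟨g6, g6', -⟩ := gpFloor_bounds hG w b u'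
  obtain ⟨g7, g7', -⟩ := gpFloor_bounds hG w b v
  obtain ⟨f1, f1'⟩ := hR.dist_le_of_gpFloor hG u a v
  obtain ⟨f2, f2'⟩ := hR.dist_le_of_gpFloor hG u' b v
  obtain ⟨f3, f3'⟩ := hR.dist_le_of_gpFloor hG u u' v
  obtain ⟨c1, c1'⟩ := hR.dist_le_of_gpFloor hG a v b
  have c2 := hR.dist_le_of_gpFloor_chain hG (x := a) (y := u) (z := u') (u := b)
  have c3 := hR.dist_le_of_gpFloor_chain hG (x := a) (y := v) (z := u') (u := b)
  have c4 := hR.dist_le_of_gpFloor_chain hG (x := b) (y := u') (z := v) (u := a)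
  simp only [gpFloor_comm G w u a, gpFloor_comm G w v a,
    gpFloor_comm G w v u', gpFloor_comm G w u' b, gpFloor_comm G w v b,
    G.dist_comm (u := a) (v := v), G.dist_comm (u := u) (v := v),
    G.dist_comm (u := u') (v := v), G.dist_comm (u := b) (v := v),
    G.dist_comm (u := b) (v := a)] at *
  generalize gpFloor G w a u = p at *
  generalize gpFloor G w b u' = q at *
  generalize gpFloor G w a v = k at *
  generalize gpFloor G w b v = l at *
  generalize gpFloor G w u u' = m at *
  generalize gpFloor G w u v = s at *
  generalize gpFloor G w u' v = s' at *
  obtain h1 | ⟨h1, h2, h⟩ := h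
  on_goal 1 => obtain h2 | h2 := le_total q l
  · specialize f1 h1
    specialize f2 h2
    obtain h | h := le_total k l
    · specialize c1 h
      linarith
    · specialize c1' h
      linarith
  · specialize f1 h1
    specialize f2' h2
    obtain h | h := le_total k q
    · obtain ⟨c, c'⟩ := c3 h
      obtain h' | h' := le_total s' k
      · specialize c h'
        linarith
      · obtain h3 | h3 := le_total m s'
        · specialize f3 h3
          rcases c' h' with c' | c' <;> linarith
        · specialize f3' h3
          rcases c' h' with c' | c' <;> linarith
    · obtain ⟨c, c'⟩ := c4 h
      obtain h' | h' := le_total s' q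
      · specialize c h'
        linarith
      · rcases c' h' with c' | c' <;> linarith
  · specialize f1' h1
    specialize f2' h2
    obtain ⟨c, c'⟩ := c2 h
    obtain h' | h' := le_total m p
    · specialize c h'
      linarith
    · obtain h3 | h3 := le_total m s'
      · specialize f3 h3
        rcases c' h' with c' | c' <;> linarith
      · specialize f3' h3
        rcases c' h' with c' | c' <;> linarith

end Corner

section Thinness

variable {G : SimpleGraph V} {w : V} {T : BFSTree G w} {R : ℕ}

lemma IsGeodesic.reverse {x y : V} {p : G.Walk x y} (hp : IsGeodesic G p) :
    IsGeodesic G p.reverse := by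
  unfold IsGeodesic at *
  rw [Walk.length_reverse, hp, G.dist_comm]

lemma IsGeodesic.dist_add_dist (hG : G.Connected) {x y a : V} {p : G.Walk x y}
    (hp : IsGeodesic G p) (ha : a ∈ p.support) : G.dist x a + G.dist a y = G.dist x y := by
  classical
  have h := congrArg Walk.length (p.take_spec ha)
  rw [Walk.length_append] at h
  have h1 := dist_le (p.takeUntil a ha)
  have h2 := dist_le (p.dropUntil a ha)
  have h3 := hG.dist_triangle (u := x) (v := a) (w := y)
  unfold IsGeodesic at hp
  omega

lemma exists_isGeodesic_mem_support (hG : G.Connected) {x y a : V}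
    (h : G.dist x a + G.dist a y = G.dist x y) :
    ∃ p : G.Walk x y, IsGeodesic G p ∧ a ∈ p.support := by
  obtain ⟨p, hp⟩ := hG.exists_walk_length_eq_dist x a
  obtain ⟨q, hq⟩ := hG.exists_walk_length_eq_dist a y
  refine ⟨p.append q, ?_, ?_⟩
  · rw [IsGeodesic, Walk.length_append, hp, hq, h]
  · simp

lemma RootedInsizeLE.thinCorner (hG : G.Connected) (hR : RootedInsizeLE T R) {v u u' : V}
    {p : G.Walk v u} {q : G.Walk v u'} (hp : IsGeodesic G p) (hq : IsGeodesic G q) :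
    ThinCorner G (7 * R + 4) p q := by
  intro a ha b hb hab ht
  have ht' : 2 * G.dist v a + G.dist u u' ≤ G.dist v u + G.dist v u' := by
    rw [gp, G.dist_comm (u := u) (v := v), G.dist_comm (u := u') (v := v)] at ht
    have : 2 * (G.dist v a : ℝ) + G.dist u u' ≤ G.dist v u + G.dist v u' := by linarith
    exact_mod_cast this
  exact_mod_cast hR.dist_le_of_corner hG (hp.dist_add_dist hG ha) (hq.dist_add_dist hG hb) hab ht'

lemma RootedInsizeLE.triangleThin (hG : G.Connected) (hR : RootedInsizeLE T R) {x y z : V}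
    {p : G.Walk x y} {q : G.Walk y z} {r : G.Walk z x} (hp : IsGeodesic G p)
    (hq : IsGeodesic G q) (hr : IsGeodesic G r) : TriangleThin G (7 * R + 4) p q r :=
  ⟨hR.thinCorner hG hp hr.reverse, hR.thinCorner hG hq hp.reverse, hR.thinCorner hG hr hq.reverse⟩

lemma dist_treeVert_le_of_forall_triangleThin (hG : G.Connected) (T : BFSTree G w) {δ : ℝ}
    (hδ : ∀ (x y z : V) (p : G.Walk x y) (q : G.Walk y z) (r : G.Walk z x),
      IsGeodesic G p → IsGeodesic G q → IsGeodesic G r → TriangleThin G δ p q r) (x y : V) :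
    (G.dist (treeVert G T x (gpFloor G w x y)) (treeVert G T y (gpFloor G w x y)) : ℝ) ≤ δ := by
  obtain ⟨h, -, hx, hy⟩ := gpFloor_bounds hG w x y
  have key : ∀ z, gpFloor G w x y ≤ G.dist w z → ∃ p : G.Walk w z, IsGeodesic G p ∧
      treeVert G T z (gpFloor G w x y) ∈ p.support := by
    intro z hz
    apply exists_isGeodesic_mem_support hG
    have h1 := dist_treeVert T z hz
    have h2 := dist_treeVert_self_le T hG z (gpFloor G w x y)
    have h3 := hG.dist_triangle (u := w) (v := treeVert G T z (gpFloor G w x y)) (w := z)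
    omega
  obtain ⟨p, hp, hxp⟩ := key x hx
  obtain ⟨r, hr, hyr⟩ := key y hy
  obtain ⟨q, hq⟩ := hG.exists_walk_length_eq_dist x y
  refine (hδ w x y p q r.reverse hp hq hr.reverse).1 _ hxp _ (by simpa using hyr) ?_ ?_
  · rw [dist_treeVert T x hx, dist_treeVert T y hy]
  · rw [dist_treeVert T x hx, ← floor_gp hG]
    refine Nat.floor_le ?_
    have : (G.dist x y : ℝ) ≤ G.dist x w + G.dist w y := mod_cast hG.dist_triangle
    rw [gp, G.dist_comm (u := y) (v := w)]
    linarith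

end Thinness

/-- `τ(G) ≤ 7·ρ_{w,T}(G) + 4 ≤ 7·τ(G) + 4`. -/
theorem thinness_le_seven_rootedInsize
    {V : Type*} [Fintype V] (G : SimpleGraph V) (hG : G.Connected)
    (w : V) (T : BFSTree G w) :
    thinness G ≤ 7 * rootedInsize G T + 4 ∧
      7 * rootedInsize G T + 4 ≤ 7 * thinness G + 4 := by
  set S : Set ℝ := {ρ : ℝ | ∃ x y : V,
    ρ = (G.dist (treeVert G T x ⌊gp G x y w⌋₊) (treeVert G T y ⌊gp G x y w⌋₊) : ℝ)} with hS
  have hne : S.Nonempty := ⟨_, w, w, rfl⟩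
  have hfin : S.Finite := by
    refine (Set.finite_range fun z : V × V => (G.dist (treeVert G T z.1 ⌊gp G z.1 z.2 w⌋₊)
      (treeVert G T z.2 ⌊gp G z.1 z.2 w⌋₊) : ℝ)).subset ?_
    rintro _ ⟨x, y, rfl⟩
    exact ⟨(x, y), rfl⟩
  obtain ⟨R, hR, hRI⟩ : ∃ R : ℕ, rootedInsize G T = R ∧ RootedInsizeLE T R := by
    obtain ⟨x, y, h⟩ := hne.csSup_mem hfin
    refine ⟨_, h, fun x' y' => ?_⟩
    have := le_csSup hfin.bddAbove (show _ ∈ S from ⟨x', y', rfl⟩)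
    rw [h, Nat.cast_le, floor_gp hG w x' y'] at this
    exact this
  constructor
  · rw [hR]
    refine csInf_le ⟨0, fun δ hδ => ?_⟩ fun x y z p q r hp hq hr => hRI.triangleThin hG hp hq hr
    exact (Nat.cast_nonneg _).trans (dist_treeVert_le_of_forall_triangleThin hG T hδ w w)
  · have : rootedInsize G T ≤ thinness G := by
      refine le_csInf ⟨_, fun x y z p q r hp hq hr => hRI.triangleThin hG hp hq hr⟩ fun δ hδ => ?_
      refine csSup_le hne ?_
      rintro _ ⟨x, y, rfl⟩
      rw [floor_gp hG]
      exact dist_treeVert_le_of_forall_triangleThin hG T hδ x y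
    linarith

end HypPaper
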